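/- arXiv:0812.3482 — 2 statements merged into one kernel-verified Lean document; each statement's English description precedes it below -/
import Mathlib

section
/- If H₀ is self-adjoint and bounded from below, and H' is symmetric with ‖H'Ψ‖ ≤ a‖H₀Ψ‖ + b‖Ψ‖ for all Ψ in D(H₀) with a < 1, then H = H₀ + H' is self-adjoint on D(H₀), essentially self-adjoint on any core of H₀, and bounded from below. -/
open scoped InnerProductSpace

open Filter Topology

/-- A self-adjoint operator shifted by a real number is onto as soon as it is bounded away from
zero. -/
theorem IsSelfAdjoint.exists_apply_add_smul_eq {E : Type*} [NormedAddCommGroup E]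
    [InnerProductSpace ℂ E] [CompleteSpace E] {T : E →ₗ.[ℂ] E} (hT : IsSelfAdjoint T) {s δ : ℝ}
    (hδ : 0 < δ) (h : ∀ ψ : T.domain, δ * ‖(ψ : E)‖ ≤ ‖T ψ + (s : ℂ) • (ψ : E)‖) (y : E) :
    ∃ ψ : T.domain, T ψ + (s : ℂ) • (ψ : E) = y := by
  set A : T.domain →ₗ[ℂ] E := T.toFun + (s : ℂ) • T.domain.subtype with hA
  have hA' : ∀ ψ : T.domain, A ψ = T ψ + (s : ℂ) • (ψ : E) := fun ψ => rfl
  have hclosed : IsClosed ((LinearMap.range A : Submodule ℂ E) : Set E) := by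
    refine isClosed_of_closure_subset fun z hz => ?_
    obtain ⟨u, hu, hlim⟩ := mem_closure_iff_seq_limit.1 hz
    choose ψ hψ using hu
    have hcauchy : CauchySeq fun n => (ψ n : E) := by
      rw [Metric.cauchySeq_iff]
      intro ε hε
      obtain ⟨N, hN⟩ := Metric.cauchySeq_iff.1 hlim.cauchySeq (δ * ε) (by positivity)
      refine ⟨N, fun m hm n hn => ?_⟩
      have h1 := hN m hm n hn
      rw [dist_eq_norm, ← hψ, ← hψ, ← map_sub] at h1
      have h2 := h (ψ m - ψ n)
      rw [← hA'] at h2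
      rw [dist_eq_norm]
      exact lt_of_mul_lt_mul_left (h2.trans_lt h1) hδ.le
    obtain ⟨x, hx⟩ := cauchySeq_tendsto_of_complete hcauchy
    have hTψ : Tendsto (fun n => T (ψ n)) atTop (𝓝 (z - (s : ℂ) • x)) := by
      have : (fun n => T (ψ n)) = fun n => u n - (s : ℂ) • (ψ n : E) := by
        ext n
        rw [← hψ, hA', add_sub_cancel_right]
      rw [this]
      exact hlim.sub (hx.const_smul _)
    have hmem : (x, z - (s : ℂ) • x) ∈ T.graph :=
      hT.isClosed.mem_of_tendsto (hx.prodMk_nhds hTψ)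
        (Eventually.of_forall fun n => T.mem_graph (ψ n))
    obtain ⟨w, hw, hTw⟩ := (LinearPMap.mem_graph_iff T).1 hmem
    dsimp only at hw hTw
    exact ⟨w, by rw [hA', hTw, hw, sub_add_cancel]⟩
  have hortho : (LinearMap.range A)ᗮ = ⊥ := by
    rw [Submodule.eq_bot_iff]
    intro v hv
    have hin : ∀ ψ : T.domain, ⟪-((s : ℂ) • v), (ψ : E)⟫_ℂ = ⟪v, T ψ⟫_ℂ := by
      intro ψ
      have := (Submodule.mem_orthogonal' _ _).1 hv (A ψ) ⟨ψ, rfl⟩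
      rw [hA', inner_add_right, inner_smul_right] at this
      rw [inner_neg_left, inner_smul_left, Complex.conj_ofReal]
      linear_combination -this
    have hv' : v ∈ T.adjoint.domain := T.mem_adjoint_domain_of_exists v ⟨_, hin⟩
    have hTv := LinearPMap.adjoint_apply_eq hT.dense_domain ⟨v, hv'⟩ hin
    have hg : (v, -((s : ℂ) • v)) ∈ T.adjoint.graph :=
      (LinearPMap.mem_graph_iff _).2 ⟨⟨v, hv'⟩, rfl, hTv⟩
    rw [LinearPMap.isSelfAdjoint_def.1 hT] at hg
    obtain ⟨w, hw, hTw⟩ := (LinearPMap.mem_graph_iff T).1 hg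
    dsimp only at hw hTw
    have h1 := h w
    rw [hTw, hw, neg_add_cancel, norm_zero] at h1
    exact norm_le_zero_iff.1 (by nlinarith [norm_nonneg v])
  have : CompleteSpace (LinearMap.range A) := hclosed.completeSpace_coe
  have htop := (Submodule.orthogonal_eq_bot_iff).1 hortho
  exact LinearMap.range_eq_top.1 htop y

/-- A densely defined symmetric operator having a real shift that is onto is self-adjoint. -/
theorem LinearPMap.isSelfAdjoint_of_exists_apply_add_smul_eq {E : Type*} [NormedAddCommGroup E]
    [InnerProductSpace ℂ E] [CompleteSpace E] {T : E →ₗ.[ℂ] E} (hd : Dense (T.domain : Set E))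
    (hsymm : T.IsFormalAdjoint T) {s : ℝ}
    (h : ∀ y, ∃ ψ : T.domain, T ψ + (s : ℂ) • (ψ : E) = y) : IsSelfAdjoint T := by
  have hle := hsymm.le_adjoint hd
  rw [LinearPMap.isSelfAdjoint_def]
  refine (LinearPMap.eq_of_le_of_domain_eq hle (le_antisymm hle.1 fun y hy => ?_)).symm
  obtain ⟨ψ, hψ⟩ := h (T.adjoint ⟨y, hy⟩ + (s : ℂ) • y)
  suffices y = ψ from this ▸ ψ.2
  refine ext_inner_right ℂ fun z => ?_
  obtain ⟨φ, rfl⟩ := h z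
  have h1 := LinearPMap.adjoint_isFormalAdjoint hd ⟨y, hy⟩ φ
  have h2 := hsymm ψ φ
  have h3 := congrArg (fun x => ⟪x, (φ : E)⟫_ℂ) hψ
  simp only [inner_add_left, inner_smul_left, Complex.conj_ofReal] at h3
  simp only [inner_add_right, inner_smul_right]
  linear_combination -h1 + h2 - h3

/-- A nonnegative log-convex sequence of growth at most `k ^ n` satisfies `q 1 ≤ k * q 0`. -/
theorem le_mul_of_sq_le_mul_of_le_mul_pow {q : ℕ → ℝ} {k C : ℝ} (hk : 0 ≤ k) (hq : ∀ n, 0 ≤ q n)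
    (hconv : ∀ n, q (n + 1) ^ 2 ≤ q n * q (n + 2)) (hbd : ∀ n, q n ≤ C * k ^ n) :
    q 1 ≤ k * q 0 := by
  by_contra! hlt
  have hq1 : 0 < q 1 := (mul_nonneg hk (hq 0)).trans_lt hlt
  have hq0 : 0 < q 0 := by
    rcases (hq 0).lt_or_eq with h | h
    · exact h
    · have := hconv 0
      rw [← h, zero_mul] at this
      exact absurd this (not_le.2 (by simpa using pow_pos hq1 2))
  set r := q 1 / q 0 with hr
  have hr0 : 0 < r := div_pos hq1 hq0
  have hkr : k < r := by rwa [hr, lt_div_iff₀ hq0]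
  have hstep : ∀ n, 0 < q n ∧ r * q n ≤ q (n + 1) := by
    intro n
    induction n with
    | zero => exact ⟨hq0, by rw [hr, div_mul_cancel₀ _ hq0.ne']⟩
    | succ n ih =>
      obtain ⟨h0, h1⟩ := ih
      have h2 : 0 < q (n + 1) := (mul_pos hr0 h0).trans_le h1
      refine ⟨h2, ?_⟩
      have h3 := hconv n
      refine le_of_mul_le_mul_left ?_ h0
      nlinarith
  have hgrow : ∀ n, r ^ n * q 0 ≤ q n := by
    intro n
    induction n with
    | zero => simp
    | succ n ih =>
      calc r ^ (n + 1) * q 0 = r * (r ^ n * q 0) := by ring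
        _ ≤ r * q n := by gcongr
        _ ≤ q (n + 1) := (hstep n).2
  have htend : Tendsto (fun n : ℕ => C * (k / r) ^ n) atTop (𝓝 (C * 0)) :=
    (tendsto_pow_atTop_nhds_zero_of_lt_one (by positivity)
      ((div_lt_one hr0).2 hkr)).const_mul C
  rw [mul_zero] at htend
  refine absurd (ge_of_tendsto' htend fun n => ?_) (not_le.2 hq0)
  rw [div_pow, ← mul_div_assoc, le_div_iff₀ (by positivity), mul_comm]
  exact (hgrow n).trans (hbd n)

/-- Cauchy-Schwarz inequality for a positive operator. -/
theorem ContinuousLinearMap.IsPositive.norm_inner_sq_le {E : Type*} [NormedAddCommGroup E]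
    [InnerProductSpace ℂ E] {S : E →L[ℂ] E} (hS : S.IsPositive) (x y : E) :
    ‖⟪S x, y⟫_ℂ‖ ^ 2 ≤ (⟪S x, x⟫_ℂ).re * (⟪S y, y⟫_ℂ).re := by
  let c : PreInnerProductSpace.Core ℂ E :=
    { inner := fun x y => ⟪S x, y⟫_ℂ
      conj_inner_symm := fun x y => by
        rw [inner_conj_symm, hS.inner_left_eq_inner_right]
      re_inner_nonneg := fun x => hS.re_inner_nonneg_left x
      add_left := fun x y z => by rw [map_add, inner_add_left]
      smul_left := fun x y r => by rw [map_smul, inner_smul_left] }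
  have h : ‖⟪S x, y⟫_ℂ‖ * ‖⟪S y, x⟫_ℂ‖ ≤ (⟪S x, x⟫_ℂ).re * (⟪S y, y⟫_ℂ).re :=
    @InnerProductSpace.Core.inner_mul_inner_self_le ℂ E _ _ _ c x y
  rwa [hS.inner_left_eq_inner_right y x, norm_inner_symm y, ← sq] at h

/-- **Reid's inequality**. -/
theorem ContinuousLinearMap.IsPositive.norm_inner_apply_le {E : Type*} [NormedAddCommGroup E]
    [InnerProductSpace ℂ E] {S K : E →L[ℂ] E} (hS : S.IsPositive) {k : ℝ} (hk : 0 ≤ k)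
    (hK : ‖K‖ ≤ k) (hSK : ∀ x y, ⟪S (K x), y⟫_ℂ = ⟪S x, K y⟫_ℂ) (x : E) :
    ‖⟪S x, K x⟫_ℂ‖ ≤ k * (⟪S x, x⟫_ℂ).re := by
  have hpos : ∀ z, 0 ≤ (⟪S z, z⟫_ℂ).re := fun z => hS.re_inner_nonneg_left z
  set q : ℕ → ℝ := fun n => (⟪S ((K ^ n) x), (K ^ n) x⟫_ℂ).re with hq
  have hle : q 1 ≤ k ^ 2 * q 0 := by
    refine le_mul_of_sq_le_mul_of_le_mul_pow (C := ‖S‖ * ‖x‖ ^ 2) (by positivity)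
      (fun n => hpos _) (fun n => ?_) fun n => ?_
    · have h1 := hS.norm_inner_sq_le ((K ^ n) x) ((K ^ (n + 2)) x)
      refine le_trans ?_ h1
      have h2 : ⟪S ((K ^ (n + 1)) x), (K ^ (n + 1)) x⟫_ℂ
          = ⟪S ((K ^ n) x), (K ^ (n + 2)) x⟫_ℂ := by
        rw [pow_succ' K n, mul_apply_eq_comp, hSK, pow_succ' K (n + 1),
          pow_succ' K n]
        rfl
      rw [← h2]
      exact pow_le_pow_left₀ (hpos _) ((le_abs_self _).trans (Complex.abs_re_le_norm _)) 2
    · have h1 : ‖(K ^ n) x‖ ≤ k ^ n * ‖x‖ := by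
        induction n with
        | zero => simp
        | succ n ih =>
          rw [pow_succ' K n, mul_apply_eq_comp]
          calc ‖K ((K ^ n) x)‖ ≤ ‖K‖ * ‖(K ^ n) x‖ := K.le_opNorm _
            _ ≤ k * (k ^ n * ‖x‖) := by gcongr
            _ = k ^ (n + 1) * ‖x‖ := by ring
      calc q n ≤ ‖⟪S ((K ^ n) x), (K ^ n) x⟫_ℂ‖ :=
            (le_abs_self _).trans (Complex.abs_re_le_norm _)
        _ ≤ ‖S ((K ^ n) x)‖ * ‖(K ^ n) x‖ := norm_inner_le_norm _ _
        _ ≤ (‖S‖ * ‖(K ^ n) x‖) * ‖(K ^ n) x‖ := by gcongr; exact S.le_opNorm _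
        _ ≤ (‖S‖ * (k ^ n * ‖x‖)) * (k ^ n * ‖x‖) := by gcongr
        _ = ‖S‖ * ‖x‖ ^ 2 * (k ^ 2) ^ n := by ring
  have h1 := hS.norm_inner_sq_le x (K x)
  simp only [hq, pow_one, pow_zero, one_apply_eq_self] at hle
  refine (sq_le_sq₀ (norm_nonneg _) (mul_nonneg hk (hpos x))).1 ?_
  nlinarith [hpos x]

theorem norm_le_norm_add_smul_of_re_inner_nonneg {E : Type*} [NormedAddCommGroup E]
    [InnerProductSpace ℂ E] {x y : E} (h : 0 ≤ (⟪x, y⟫_ℂ).re) {μ : ℝ} (hμ : 0 ≤ μ) :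
    ‖y‖ ≤ ‖y + (μ : ℂ) • x‖ ∧ μ * ‖x‖ ≤ ‖y + (μ : ℂ) • x‖ := by
  have h1 : ‖y + (μ : ℂ) • x‖ ^ 2 = ‖y‖ ^ 2 + 2 * (μ * (⟪x, y⟫_ℂ).re) + (μ * ‖x‖) ^ 2 := by
    rw [norm_add_sq (𝕜 := ℂ), inner_smul_right, norm_smul, Complex.norm_real,
      Real.norm_of_nonneg hμ, RCLike.re_to_complex, Complex.re_ofReal_mul,
      ← inner_conj_symm, Complex.conj_re]
  have h2 := mul_nonneg hμ h
  constructor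
  · refine (sq_le_sq₀ (norm_nonneg _) (norm_nonneg _)).1 ?_
    nlinarith [sq_nonneg (μ * ‖x‖)]
  · refine (sq_le_sq₀ (by positivity) (norm_nonneg _)).1 ?_
    nlinarith [sq_nonneg ‖y‖]

/-- Perturbation of a strictly positive symmetric operator `A` onto `E` by a symmetric operator `B`
that is bounded relative to `A`. -/
theorem surjective_add_and_norm_inner_le_of_norm_le {E : Type*} [NormedAddCommGroup E]
    [InnerProductSpace ℂ E] [CompleteSpace E] {D : Submodule ℂ E} {A B : D →ₗ[ℂ] E} {μ k : ℝ}
    (hμ : 0 < μ) (hA : ∀ x y : D, ⟪A x, (y : E)⟫_ℂ = ⟪(x : E), A y⟫_ℂ)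
    (hB : ∀ x y : D, ⟪B x, (y : E)⟫_ℂ = ⟪(x : E), B y⟫_ℂ)
    (hpos : ∀ x : D, 0 ≤ (⟪(x : E), A x⟫_ℂ).re) (hμA : ∀ x : D, μ * ‖(x : E)‖ ≤ ‖A x‖)
    (hsurj : Function.Surjective A) (hk : 0 ≤ k) (hk1 : k < 1) (hBA : ∀ x, ‖B x‖ ≤ k * ‖A x‖) :
    Function.Surjective (A + B) ∧ ∀ x : D, ‖⟪(x : E), B x⟫_ℂ‖ ≤ k * (⟪(x : E), A x⟫_ℂ).re := by
  have hinj : Function.Injective A := by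
    refine (injective_iff_map_eq_zero A).2 fun x hx => ?_
    have h1 := hμA x
    rw [hx, norm_zero] at h1
    have h2 : ‖(x : E)‖ ≤ 0 := by nlinarith [norm_nonneg (x : E)]
    exact Subtype.ext (norm_le_zero_iff.1 h2)
  let e := LinearEquiv.ofBijective A ⟨hinj, hsurj⟩
  have he : ∀ y, A (e.symm y) = y := fun y => e.apply_symm_apply y
  have he' : ∀ x, e.symm (A x) = x := fun x => e.symm_apply_apply x
  let S : E →L[ℂ] E := (D.subtype ∘ₗ e.symm.toLinearMap).mkContinuous μ⁻¹ fun y => by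
    have h1 := hμA (e.symm y)
    rw [he] at h1
    rw [inv_mul_eq_div, le_div_iff₀ hμ, mul_comm]
    exact h1
  have hKb : ∀ y, ‖(B ∘ₗ e.symm.toLinearMap) y‖ ≤ k * ‖y‖ := fun y => by
    have h1 := hBA (e.symm y)
    rwa [he] at h1
  let K : E →L[ℂ] E := (B ∘ₗ e.symm.toLinearMap).mkContinuous k hKb
  have hK : ‖K‖ ≤ k := LinearMap.mkContinuous_norm_le _ hk hKb
  have hSapp : ∀ y, S y = e.symm y := fun y => rfl
  have hKapp : ∀ y, K y = B (e.symm y) := fun y => rfl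
  have hSpos : S.IsPositive := by
    refine ⟨fun x y => ?_, fun x => ?_⟩
    · have h1 := hA (e.symm x) (e.symm y)
      rw [he, he] at h1
      exact h1.symm
    · have h1 := hpos (e.symm x)
      rw [he] at h1
      exact h1
  have hSK : ∀ x y, ⟪S (K x), y⟫_ℂ = ⟪S x, K y⟫_ℂ := fun x y => by
    have h1 := hSpos.inner_left_eq_inner_right (K x) y
    rw [h1, hKapp, hKapp, hSapp, hSapp, hB]
  constructor
  · intro y
    have hu : IsUnit (1 - -K) := isUnit_one_sub_of_norm_lt_one (by rw [norm_neg]; linarith)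
    obtain ⟨u, hu⟩ := hu
    refine ⟨e.symm ((↑u⁻¹ : E →L[ℂ] E) y), ?_⟩
    have h1 : (u : E →L[ℂ] E) ((↑u⁻¹ : E →L[ℂ] E) y) = y := by
      rw [← mul_apply_eq_comp, Units.mul_inv, one_apply_eq_self]
    rw [hu, sub_neg_eq_add, add_apply, one_apply_eq_self, hKapp] at h1
    rw [LinearMap.add_apply, he, h1]
  · intro x
    have h1 := hSpos.norm_inner_apply_le hk hK hSK (A x)
    rwa [hSapp, hKapp, he'] at h1

/-- A relatively bounded perturbation of an operator with core `T₀` has the same core. -/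
theorem LinearPMap.closure_add_eq_of_norm_le {E : Type*} [NormedAddCommGroup E] [NormedSpace ℂ E]
    {T₀ T S : E →ₗ.[ℂ] E} {a b : ℝ} (hT : T.IsClosed) (hTS : (T + S).IsClosed)
    (hdom : T.domain ≤ S.domain)
    (hrel : ∀ ψ : T.domain, ‖S ⟨(ψ : E), hdom ψ.2⟩‖ ≤ a * ‖T ψ‖ + b * ‖(ψ : E)‖)
    (hle : T₀ ≤ T) (hcl : T₀.closure = T) : (T₀ + S).closure = T + S := by
  have hle' : T₀ + S ≤ T + S := by
    refine ⟨inf_le_inf_right _ hle.1, fun x y hxy => ?_⟩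
    rw [LinearPMap.add_apply, LinearPMap.add_apply,
      hle.2 (x := ⟨x, x.2.1⟩) (y := ⟨y, y.2.1⟩) hxy]
    congr 2
    exact Subtype.ext hxy
  have hclos : (T₀ + S).IsClosable := hTS.isClosable.leIsClosable hle'
  have hclos₀ : T₀.IsClosable := hT.isClosable.leIsClosable hle
  refine LinearPMap.eq_of_eq_graph ?_
  rw [← hclos.graph_closure_eq_closure_graph]
  refine le_antisymm (Submodule.topologicalClosure_minimal _ (LinearPMap.le_graph_of_le hle') hTS)
    fun p hp => ?_
  obtain ⟨ψ, hψ, hTSψ⟩ := (LinearPMap.mem_graph_iff _).1 hp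
  have hmem : ((ψ : E), T ⟨ψ, ψ.2.1⟩) ∈ T₀.graph.topologicalClosure := by
    rw [hclos₀.graph_closure_eq_closure_graph, hcl]
    exact T.mem_graph ⟨ψ, ψ.2.1⟩
  obtain ⟨u, hu, hlim⟩ := mem_closure_iff_seq_limit.1 hmem
  choose φ hφ hTφ using fun n => (LinearPMap.mem_graph_iff _).1 (hu n)
  have hlim1 : Tendsto (fun n => (φ n : E)) atTop (𝓝 (ψ : E)) := by
    simpa only [hφ] using hlim.fst_nhds
  have hlim2 : Tendsto (fun n => T₀ (φ n)) atTop (𝓝 (T ⟨ψ, ψ.2.1⟩)) := by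
    simpa only [hTφ] using hlim.snd_nhds
  have hφS : ∀ n, (φ n : E) ∈ S.domain := fun n => hdom (hle.1 (φ n).2)
  have hlim3 : Tendsto (fun n => S ⟨φ n, hφS n⟩) atTop (𝓝 (S ⟨ψ, ψ.2.2⟩)) := by
    rw [tendsto_iff_norm_sub_tendsto_zero]
    have hbound : Tendsto
        (fun n => a * ‖T₀ (φ n) - T ⟨ψ, ψ.2.1⟩‖ + b * ‖(φ n : E) - (ψ : E)‖) atTop
        (𝓝 (a * 0 + b * 0)) :=
      ((tendsto_iff_norm_sub_tendsto_zero.1 hlim2).const_mul a).add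
        ((tendsto_iff_norm_sub_tendsto_zero.1 hlim1).const_mul b)
    rw [mul_zero, mul_zero, add_zero] at hbound
    refine squeeze_zero (fun n => norm_nonneg _) (fun n => ?_) hbound
    have h1 := hrel (⟨φ n, hle.1 (φ n).2⟩ - ⟨ψ, ψ.2.1⟩)
    rw [T.map_sub, ← hle.2 (x := φ n) (y := ⟨φ n, hle.1 (φ n).2⟩) rfl] at h1
    rw [← S.map_sub]
    exact h1
  refine mem_closure_iff_seq_limit.2
    ⟨fun n => ((φ n : E), T₀ (φ n) + S ⟨φ n, hφS n⟩),
      fun n => (T₀ + S).mem_graph ⟨φ n, (φ n).2, hφS n⟩, ?_⟩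
  have hp' : p = ((ψ : E), T ⟨ψ, ψ.2.1⟩ + S ⟨ψ, ψ.2.2⟩) := Prod.ext hψ.symm hTSψ.symm
  rw [hp']
  exact hlim1.prodMk_nhds (hlim2.add hlim3)

/-- **Kato–Rellich theorem.** If `H₀` is self-adjoint and bounded from below, and `H'` is
symmetric with `D(H') ⊇ D(H₀)` and `‖H'Ψ‖ ≤ a‖H₀Ψ‖ + b‖Ψ‖` on `D(H₀)` with `a < 1`,
then `H = H₀ + H'` is self-adjoint on `D(H₀)`, essentially self-adjoint on any core of `H₀`
(i.e. the restriction of `H` to any core of `H₀` has closure `H`), and bounded from below. -/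
theorem stmt_1 {E : Type*} [NormedAddCommGroup E] [InnerProductSpace ℂ E] [CompleteSpace E]
    (H₀ H' : E →ₗ.[ℂ] E) (a b c₀ : ℝ)
    (hsa : IsSelfAdjoint H₀)
    (hbelow : ∀ ψ : H₀.domain, c₀ * ‖(ψ : E)‖ ^ 2 ≤ (⟪(ψ : E), H₀ ψ⟫_ℂ).re)
    (hdom : H₀.domain ≤ H'.domain)
    (hsymm : ∀ φ ψ : H'.domain, ⟪H' φ, (ψ : E)⟫_ℂ = ⟪(φ : E), H' ψ⟫_ℂ)
    (ha : 0 ≤ a) (ha1 : a < 1) (hb : 0 ≤ b)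
    (hrel : ∀ ψ : H₀.domain, ‖H' ⟨(ψ : E), hdom ψ.2⟩‖ ≤ a * ‖H₀ ψ‖ + b * ‖(ψ : E)‖) :
    (H₀ + H').domain = H₀.domain ∧
    IsSelfAdjoint (H₀ + H') ∧
    (∀ T₀ : E →ₗ.[ℂ] E, T₀ ≤ H₀ → T₀.closure = H₀ →
      (T₀ + H').closure = H₀ + H') ∧
    (∃ c : ℝ, ∀ ψ : (H₀ + H').domain,
      c * ‖(ψ : E)‖ ^ 2 ≤ (⟪(ψ : E), (H₀ + H') ψ⟫_ℂ).re) := by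
  have hnsq : ∀ y : E, (⟪y, y⟫_ℂ).re = ‖y‖ ^ 2 := inner_self_eq_norm_sq (𝕜 := ℂ)
  have hD : (H₀ + H').domain = H₀.domain := inf_eq_left.2 hdom
  have hsymm₀ : H₀.IsFormalAdjoint H₀ := by
    have h := LinearPMap.adjoint_isFormalAdjoint hsa.dense_domain
    rwa [LinearPMap.isSelfAdjoint_def.1 hsa] at h
  set M : ℝ := a * |c₀| + b with hM
  have hM0 : 0 ≤ M := by positivity
  have ha1' : 0 < 1 - a := sub_pos.2 ha1
  set μ : ℝ := (M + 1) / (1 - a) with hμdef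
  have hμ : 0 < μ := by positivity
  set k : ℝ := a + M / μ with hkdef
  have hk : 0 ≤ k := by positivity
  have hk1 : k < 1 := by
    have h1 : M / μ < 1 - a := by
      rw [div_lt_iff₀ hμ, hμdef, mul_div_cancel₀ _ ha1'.ne']
      exact lt_add_one M
    linarith
  set s : ℝ := μ - c₀ with hs
  let A : H₀.domain →ₗ[ℂ] E := H₀.toFun + (s : ℂ) • H₀.domain.subtype
  let B : H₀.domain →ₗ[ℂ] E := H'.toFun ∘ₗ Submodule.inclusion hdom
  have hAapp : ∀ x : H₀.domain, A x = H₀ x + (s : ℂ) • (x : E) := fun x => rfl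
  have hBapp : ∀ x : H₀.domain, B x = H' ⟨x, hdom x.2⟩ := fun x => rfl
  have hshift : ∀ x : H₀.domain, 0 ≤ (⟪(x : E), H₀ x - (c₀ : ℂ) • (x : E)⟫_ℂ).re := by
    intro x
    rw [inner_sub_right, inner_smul_right, Complex.sub_re, Complex.re_ofReal_mul, hnsq]
    exact sub_nonneg.2 (hbelow x)
  have hAshift : ∀ x : H₀.domain, A x = (H₀ x - (c₀ : ℂ) • (x : E)) + (μ : ℂ) • (x : E) := by
    intro x
    rw [hAapp, hs, Complex.ofReal_sub, sub_smul]
    abel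
  have hnorm := fun x : H₀.domain =>
    norm_le_norm_add_smul_of_re_inner_nonneg (hshift x) hμ.le
  simp only [← hAshift] at hnorm
  have hpos : ∀ x : H₀.domain, 0 ≤ (⟪(x : E), A x⟫_ℂ).re := by
    intro x
    rw [hAshift, inner_add_right, Complex.add_re, inner_smul_right, Complex.re_ofReal_mul]
    exact add_nonneg (hshift x) (mul_nonneg hμ.le (inner_self_nonneg (𝕜 := ℂ)))
  have hBA : ∀ x, ‖B x‖ ≤ k * ‖A x‖ := by
    intro x
    obtain ⟨h1, h2⟩ := hnorm x
    have h3 : ‖H₀ x‖ ≤ ‖A x‖ + |c₀| * ‖(x : E)‖ := by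
      calc ‖H₀ x‖ = ‖(H₀ x - (c₀ : ℂ) • (x : E)) + (c₀ : ℂ) • (x : E)‖ := by
            rw [sub_add_cancel]
        _ ≤ ‖H₀ x - (c₀ : ℂ) • (x : E)‖ + ‖(c₀ : ℂ) • (x : E)‖ := norm_add_le _ _
        _ ≤ ‖A x‖ + |c₀| * ‖(x : E)‖ := by
            rw [norm_smul, Complex.norm_real, Real.norm_eq_abs]
            gcongr
    have h4 : ‖(x : E)‖ ≤ ‖A x‖ / μ := by rwa [le_div_iff₀ hμ, mul_comm]
    calc ‖B x‖ ≤ a * ‖H₀ x‖ + b * ‖(x : E)‖ := hrel x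
      _ ≤ a * (‖A x‖ + |c₀| * ‖(x : E)‖) + b * ‖(x : E)‖ := by gcongr
      _ = a * ‖A x‖ + M * ‖(x : E)‖ := by rw [hM]; ring
      _ ≤ a * ‖A x‖ + M * (‖A x‖ / μ) := by gcongr
      _ = k * ‖A x‖ := by rw [hkdef]; ring
  have hAsymm : ∀ x y : H₀.domain, ⟪A x, (y : E)⟫_ℂ = ⟪(x : E), A y⟫_ℂ := by
    intro x y
    rw [hAapp, hAapp, inner_add_left, inner_add_right, inner_smul_left, inner_smul_right,
      Complex.conj_ofReal, hsymm₀ x y]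
  obtain ⟨hsurj, hform⟩ := surjective_add_and_norm_inner_le_of_norm_le hμ hAsymm
    (fun x y => hsymm ⟨x, hdom x.2⟩ ⟨y, hdom y.2⟩) hpos (fun x => (hnorm x).2)
    (hsa.exists_apply_add_smul_eq hμ fun x => (hnorm x).2) hk hk1 hBA
  have hH : IsSelfAdjoint (H₀ + H') := by
    refine LinearPMap.isSelfAdjoint_of_exists_apply_add_smul_eq (s := s)
      (hD ▸ hsa.dense_domain) (fun x y => ?_) fun y => ?_
    · rw [LinearPMap.add_apply, LinearPMap.add_apply, inner_add_left, inner_add_right]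
      exact congrArg₂ _ (hsymm₀ ⟨x, x.2.1⟩ ⟨y, y.2.1⟩) (hsymm ⟨x, x.2.2⟩ ⟨y, y.2.2⟩)
    · obtain ⟨x, hx⟩ := hsurj y
      refine ⟨⟨x, x.2, hdom x.2⟩, ?_⟩
      rw [← hx, LinearMap.add_apply, hAapp, hBapp, LinearPMap.add_apply]
      exact add_right_comm _ _ _
  refine ⟨hD, hH, fun T₀ hle hcl =>
    LinearPMap.closure_add_eq_of_norm_le hsa.isClosed hH.isClosed hdom hrel hle hcl,
    -s, fun ψ => ?_⟩
  let x : H₀.domain := ⟨ψ, ψ.2.1⟩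
  have h1 : (H₀ + H') ψ = A x - (s : ℂ) • (ψ : E) + B x := by
    rw [hAapp, hBapp, LinearPMap.add_apply, add_sub_cancel_right]
  have h2 := (Complex.abs_re_le_norm _).trans (hform x)
  have h3 := neg_le_of_abs_le h2
  have h4 := mul_nonneg (sub_nonneg.2 hk1.le) (hpos x)
  rw [h1, inner_add_right, inner_sub_right, inner_smul_right, Complex.add_re, Complex.sub_re,
    Complex.re_ofReal_mul, hnsq]
  change -(k * (⟪(ψ : E), A x⟫_ℂ).re) ≤ (⟪(ψ : E), B x⟫_ℂ).re at h3
  change 0 ≤ (1 - k) * (⟪(ψ : E), A x⟫_ℂ).re at h4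
  linarith
end

section
/- Let H_n (n ∈ ℕ) and H be self-adjoint operators, bounded below uniformly, such that H_n → H in norm resolvent sense. If each H_n has purely discrete spectrum in [E₀(H_n), E₀(H_n) + m) for a fixed m > 0, and E₀(H_n) → E₀(H), then H has purely discrete spectrum in [E₀(H), E₀(H) + m); in particular H has a ground state. -/
open Filter
open scoped Topology

noncomputable section

variable {E : Type*} [NormedAddCommGroup E] [InnerProductSpace ℂ E] [CompleteSpace E]

/-- `R` is a bounded two-sided inverse of `T - z`. -/
def IsResolventAt (T : E →ₗ.[ℂ] E) (z : ℂ) (R : E →L[ℂ] E) : Prop :=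
  (∀ x : E, ∃ h : R x ∈ T.domain, T ⟨R x, h⟩ - z • R x = x) ∧
  (∀ y : T.domain, R (T y - z • (y : E)) = (y : E))

/-- The spectrum of an unbounded operator. -/
def pSpectrum (T : E →ₗ.[ℂ] E) : Set ℂ :=
  {z | ¬ ∃ R : E →L[ℂ] E, IsResolventAt T z R}

/-- `z` is an eigenvalue of `T`. -/
def IsEigenvalue (T : E →ₗ.[ℂ] E) (z : ℂ) : Prop :=
  ∃ x : T.domain, (x : E) ≠ 0 ∧ T x = z • (x : E)

/-- The eigenspace of `T` for `z`. -/
def pEigenspace (T : E →ₗ.[ℂ] E) (z : ℂ) : Submodule ℂ T.domain :=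
  LinearMap.ker (T.toFun - z • T.domain.subtype)

/-- Ground state energy: the infimum of the (real) spectrum. -/
def groundEnergy (T : E →ₗ.[ℂ] E) : ℝ :=
  sInf {x : ℝ | (x : ℂ) ∈ pSpectrum T}

/-- `T` has purely discrete spectrum in `[a, b)`: the spectrum there consists of isolated
eigenvalues of finite multiplicity. -/
def DiscreteIn (T : E →ₗ.[ℂ] E) (a b : ℝ) : Prop :=
  ∀ z ∈ pSpectrum T, a ≤ z.re → z.re < b →
    IsEigenvalue T z ∧ FiniteDimensional ℂ (pEigenspace T z) ∧
    ∃ ε > (0 : ℝ), ∀ w ∈ pSpectrum T, ‖w - z‖ < ε → w = z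

set_option linter.unusedSectionVars false

theorem norm_cfc_sub_apply_le {R : E →L[ℂ] E} (hR : IsStarNormal R) {g : ℂ → ℂ} {L : NNReal}
    (hg : LipschitzWith L g) (w : ℂ) (x : E) :
    ‖cfc g R x - g w • x‖ ≤ L * ‖R x - w • x‖ := by
  have hgc : Continuous g := hg.continuous
  have h1 : cfc (fun z => star (g z - g w) * (g z - g w)) R ≤
      cfc (fun z => (L : ℂ) ^ 2 * (star (z - w) * (z - w))) R := by
    open scoped ComplexOrder in
    refine cfc_mono fun z _ => ?_
    have h := hg.dist_le_mul z w
    rw [dist_eq_norm, dist_eq_norm] at h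
    have e : ∀ u : ℂ, star u * u = ((‖u‖ ^ 2 : ℝ) : ℂ) := fun u => by
      simpa using RCLike.conj_mul u
    rw [e, e]
    have h2 : ‖g z - g w‖ ^ 2 ≤ (L : ℝ) ^ 2 * ‖z - w‖ ^ 2 := by
      rw [← mul_pow]; gcongr
    have h3 := Complex.real_le_real.2 h2
    push_cast at h3 ⊢
    exact h3
  have e1 : cfc (fun z => star (g z - g w) * (g z - g w)) R =
      star (cfc g R - g w • 1) * (cfc g R - g w • 1) := by
    rw [cfc_mul (fun z => star (g z - g w)) (fun z => g z - g w) R, cfc_star,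
      cfc_sub g (fun _ => g w) R, cfc_const (g w) R, Algebra.algebraMap_eq_smul_one]
  have e2 : cfc (fun z => (L : ℂ) ^ 2 * (star (z - w) * (z - w))) R =
      (L : ℂ) ^ 2 • (star (R - w • 1) * (R - w • 1)) := by
    rw [cfc_const_mul ((L : ℂ) ^ 2) (fun z => star (z - w) * (z - w)) R,
      cfc_mul (fun z => star (z - w)) (fun z => z - w) R, cfc_star,
      cfc_sub (fun z => z) (fun _ => w) R, cfc_const w R, cfc_id' ℂ R,
      Algebra.algebraMap_eq_smul_one]
  rw [e1, e2, ContinuousLinearMap.le_def] at h1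
  have h2 := h1.re_inner_nonneg_left x
  have key : ∀ A : E →L[ℂ] E, inner ℂ ((star A * A) x) x = ((‖A x‖ ^ 2 : ℝ) : ℂ) := fun A => by
    rw [ContinuousLinearMap.star_eq_adjoint, mul_apply_eq_comp,
      ContinuousLinearMap.adjoint_inner_left, inner_self_eq_norm_sq_to_K]
    simp
  rw [sub_apply, smul_apply, inner_sub_left,
    inner_smul_left, key, key] at h2
  have h3 : ‖(cfc g R - g w • 1) x‖ ^ 2 ≤ (L * ‖(R - w • 1) x‖) ^ 2 := by
    have : (starRingEnd ℂ) ((L : ℂ) ^ 2) * ((‖(R - w • 1) x‖ ^ 2 : ℝ) : ℂ) -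
        ((‖(cfc g R - g w • 1) x‖ ^ 2 : ℝ) : ℂ) =
        (((L : ℝ) ^ 2 * ‖(R - w • 1) x‖ ^ 2 - ‖(cfc g R - g w • 1) x‖ ^ 2 : ℝ) : ℂ) := by
      simp
    rw [this] at h2
    rw [mul_pow]
    simp only [RCLike.re_to_complex, Complex.ofReal_re] at h2
    linarith
  have h4 := le_of_sq_le_sq h3 (by positivity)
  simpa using h4

theorem exists_approx_eigenvector {R : E →L[ℂ] E} (hR : IsStarNormal R) {w : ℂ}
    (hw : w ∈ spectrum ℂ R) {ε : ℝ} (hε : 0 < ε) :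
    ∃ x : E, ‖x‖ = 1 ∧ ‖R x - w • x‖ < ε := by
  by_contra! hcon
  have hb : ∀ x, ε * ‖x‖ ≤ ‖R x - w • x‖ := fun x => by
    rcases eq_or_ne x 0 with rfl | hx
    · simp
    have hx' : ‖x‖ ≠ 0 := norm_ne_zero_iff.2 hx
    have h := hcon (((‖x‖⁻¹ : ℝ) : ℂ) • x) (by
      rw [norm_smul, Complex.norm_real, norm_inv, norm_norm, inv_mul_cancel₀ hx'])
    rw [map_smul, smul_comm, ← smul_sub, norm_smul, Complex.norm_real, norm_inv, norm_norm] at h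
    field_simp at h
    linarith
  refine hw ?_
  set N := algebraMap ℂ (E →L[ℂ] E) w - R with hN
  have hNn : Commute (star N) N := by
    have h : Commute (star R) R := hR.star_comm_self
    rw [hN, star_sub, ← algebraMap_star_comm]
    exact (Algebra.commute_algebraMap_left _ _).sub_left
      ((Algebra.commute_algebraMap_right _ _).sub_right h)
  have hu : IsUnit (star N * N) := by
    refine ContinuousLinearMap.isUnit_of_forall_le_norm_inner_map (c := Real.toNNReal (ε ^ 2)) _
      (Real.toNNReal_pos.2 (by positivity)) fun x => ?_
    rw [ContinuousLinearMap.star_eq_adjoint, mul_apply_eq_comp,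
      ContinuousLinearMap.adjoint_inner_left, inner_self_eq_norm_sq_to_K]
    have e : ‖N x‖ = ‖R x - w • x‖ := by
      rw [← norm_neg]; simp [hN, Algebra.algebraMap_eq_smul_one]
    simp only [norm_pow, RCLike.norm_ofReal, abs_norm, e]
    rw [Real.coe_toNNReal _ (by positivity), mul_comm, ← mul_pow]
    gcongr
    exact hb x
  exact (hNn.isUnit_mul_iff.1 hu).2

theorem exists_subseq_tendsto_eigenvector {R : E →L[ℂ] E} (hR : IsStarNormal R) {g : ℂ → ℂ}
    {L : NNReal} (hg : LipschitzWith L g) (hK : IsCompactOperator (cfc g R : E →L[ℂ] E)) {w : ℂ}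
    (hw : g w ≠ 0) {x : ℕ → E} (hx : ∀ n, ‖x n‖ = 1)
    (hxw : Tendsto (fun n => R (x n) - w • x n) atTop (𝓝 0)) :
    ∃ (y : E) (φ : ℕ → ℕ), StrictMono φ ∧ Tendsto (x ∘ φ) atTop (𝓝 y) ∧ ‖y‖ = 1 ∧
      R y = w • y := by
  obtain ⟨K, hKc, hKs⟩ := hK.image_closedBall_subset_compact 1
  obtain ⟨a, -, φ, hφ, ha⟩ := hKc.tendsto_subseq (x := fun n => cfc g R (x n))
    fun n => hKs ⟨x n, by simp [hx n], rfl⟩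
  have h0 : Tendsto (fun n => cfc g R (x n) - g w • x n) atTop (𝓝 0) := by
    refine squeeze_zero_norm (fun n => norm_cfc_sub_apply_le hR hg w (x n)) ?_
    simpa using hxw.norm.const_mul (L : ℝ)
  have h1 : Tendsto (x ∘ φ) atTop (𝓝 ((g w)⁻¹ • a)) := by
    have h2 := (ha.sub (h0.comp hφ.tendsto_atTop)).const_smul (g w)⁻¹
    simp only [sub_zero] at h2
    refine h2.congr fun n => ?_
    simp [smul_smul, hw]
  refine ⟨_, φ, hφ, h1, ?_, ?_⟩
  · refine tendsto_nhds_unique h1.norm ?_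
    simp [hx]
  · have h2 := ((R.continuous.tendsto _).comp h1).sub (h1.const_smul w)
    exact sub_eq_zero.1 (tendsto_nhds_unique h2 (hxw.comp hφ.tendsto_atTop))

theorem finiteDimensional_range_cfc {R : E →L[ℂ] E} (hR : IsStarNormal R) (s : Finset ℂ) :
    (∀ w ∈ s, FiniteDimensional ℂ (Module.End.eigenspace R.toLinearMap w)) →
    ∀ {g : ℂ → ℂ}, Continuous g → (∀ w ∈ spectrum ℂ R, w ∉ s → g w = 0) →
    FiniteDimensional ℂ (LinearMap.range (cfc g R).toLinearMap) := by
  classical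
  induction s using Finset.induction_on with
  | empty =>
    intro _ g hg h
    have : cfc g R = 0 := by
      rw [cfc_congr (g := 0) (fun w hw => h w hw (by simp)), cfc_zero]
    rw [this]
    have : LinearMap.range (0 : E →L[ℂ] E).toLinearMap = ⊥ := by
      rw [ContinuousLinearMap.toLinearMap_zero, LinearMap.range_zero]
    rw [this]
    infer_instance
  | insert w s _ ih =>
    intro hs g hg h
    have h1 := ih (fun v hv => hs v (Finset.mem_insert_of_mem hv))
      (g := fun z => (z - w) * g z) (by fun_prop) (fun v hv hvs => by
        by_cases hvw : v = w
        · simp [hvw]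
        · simp [h v hv (by simp [hvw, hvs])])
    rw [cfc_mul (fun z => z - w) g R, cfc_sub (fun z => z) (fun _ => w) R, cfc_const w R,
      cfc_id' ℂ R] at h1
    set A := R - algebraMap ℂ (E →L[ℂ] E) w with hA
    have h2 : FiniteDimensional ℂ (LinearMap.ker A.toLinearMap) := by
      have e : LinearMap.ker A.toLinearMap = Module.End.eigenspace R.toLinearMap w := by
        ext x
        simp [hA, Algebra.algebraMap_eq_smul_one, sub_eq_zero]
      rw [e]
      exact hs w (by simp)
    have h3 : FiniteDimensional ℂ (Submodule.comap A.toLinearMap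
        (LinearMap.range (A * cfc g R).toLinearMap)) := inferInstance
    refine Submodule.finiteDimensional_of_le (S₂ := Submodule.comap A.toLinearMap
        (LinearMap.range (A * cfc g R).toLinearMap)) ?_
    rintro _ ⟨x, rfl⟩
    exact ⟨x, rfl⟩

theorem isCompactOperator_of_finiteDimensional_range (K : E →L[ℂ] E)
    [FiniteDimensional ℂ (LinearMap.range K.toLinearMap)] : IsCompactOperator K := by
  have : ProperSpace (LinearMap.range K.toLinearMap) := FiniteDimensional.proper ℂ _
  exact (isCompactOperator_of_locallyCompactSpace_dom
    (K.codRestrict (LinearMap.range K.toLinearMap) fun x => ⟨x, rfl⟩)).clm_comp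
      (LinearMap.range K.toLinearMap).subtypeL

theorem IsSelfAdjoint.inner_map_left {T : E →ₗ.[ℂ] E} (hT : IsSelfAdjoint T) (x y : T.domain) :
    inner ℂ (T x) (y : E) = inner ℂ (x : E) (T y) := by
  have h := LinearPMap.adjoint_isFormalAdjoint hT.dense_domain
  rw [LinearPMap.isSelfAdjoint_def.1 hT] at h
  exact h x y

theorem IsResolventAt.resolvent_identity {T : E →ₗ.[ℂ] E} {z w : ℂ} {R Q : E →L[ℂ] E}
    (hR : IsResolventAt T z R) (hQ : IsResolventAt T w Q) : Q - R = (w - z) • (R * Q) := by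
  ext x
  obtain ⟨h, hx⟩ := hQ.1 x
  have h1 := hR.2 ⟨Q x, h⟩
  have h2 : T ⟨Q x, h⟩ - z • Q x = x + (w - z) • Q x := by
    rw [sub_smul]
    nth_rewrite 3 [← hx]
    abel
  rw [h2, map_add, map_smul] at h1
  rw [smul_apply, mul_apply_eq_comp, sub_apply, sub_eq_iff_eq_add', h1]

theorem IsResolventAt.map_of_eigenvector {T : E →ₗ.[ℂ] E} {z w : ℂ} {R : E →L[ℂ] E}
    (hR : IsResolventAt T z R) (hw : w ≠ z) {x : T.domain} (hx : T x = w • (x : E)) :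
    R x = (w - z)⁻¹ • (x : E) := by
  have h := hR.2 x
  rw [hx, ← sub_smul, map_smul] at h
  rw [eq_inv_smul_iff₀ (sub_ne_zero.2 hw), h]

theorem IsResolventAt.eigenvector_of_map {T : E →ₗ.[ℂ] E} {z w : ℂ} {R : E →L[ℂ] E}
    (hR : IsResolventAt T z R) (hw : w ≠ z) {x : E} (hx : R x = (w - z)⁻¹ • x) :
    ∃ h : x ∈ T.domain, T ⟨x, h⟩ = w • x := by
  have hx' : R ((w - z) • x) = x := by
    rw [map_smul, hx, smul_inv_smul₀ (sub_ne_zero.2 hw)]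
  obtain ⟨h, h1⟩ := hR.1 ((w - z) • x)
  simp only [hx'] at h h1
  refine ⟨h, ?_⟩
  rw [sub_eq_iff_eq_add] at h1
  rw [h1, sub_smul, sub_add_cancel]

theorem IsResolventAt.mem_pSpectrum_iff {T : E →ₗ.[ℂ] E} {z w : ℂ} {R : E →L[ℂ] E}
    (hR : IsResolventAt T z R) (hw : w ≠ z) :
    w ∈ pSpectrum T ↔ (w - z)⁻¹ ∈ spectrum ℂ R := by
  have hd : w - z ≠ 0 := sub_ne_zero.2 hw
  rw [pSpectrum, Set.mem_ofPred_eq, spectrum.mem_iff, not_iff_not, Algebra.algebraMap_eq_smul_one]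
  set N : E →L[ℂ] E := (w - z)⁻¹ • 1 - R with hN
  constructor
  · rintro ⟨Q, hQ⟩
    have h1 := hR.resolvent_identity hQ
    have h2 := hQ.resolvent_identity hR
    have e1 : N * ((w - z) • (1 + (w - z) • Q)) = 1 := by
      have : N * ((w - z) • (1 + (w - z) • Q)) =
          1 + (w - z) • (Q - R - (w - z) • (R * Q)) := by
        rw [hN]
        generalize w - z = d at hd ⊢
        simp only [sub_mul, mul_smul_comm, smul_mul_assoc, mul_add, mul_one, one_mul,
          smul_add, smul_sub, smul_smul]
        simp only [mul_inv_cancel₀ hd, mul_inv_cancel_right₀ hd, one_smul]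
        abel
      rw [this, h1]; simp
    have e2 : ((w - z) • (1 + (w - z) • Q)) * N = 1 := by
      have : ((w - z) • (1 + (w - z) • Q)) * N =
          1 + (w - z) • (Q - R - (w - z) • (Q * R)) := by
        rw [hN]
        generalize w - z = d at hd ⊢
        simp only [mul_sub, mul_smul_comm, smul_mul_assoc, add_mul, mul_one, one_mul,
          smul_add, smul_sub, smul_smul]
        simp only [inv_mul_cancel₀ hd, inv_mul_cancel_left₀ hd, one_smul]
        abel
      rw [this, ← neg_sub R Q, h2, ← neg_smul, neg_sub, sub_self, smul_zero, add_zero]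
    exact ⟨⟨N, _, e1, e2⟩, rfl⟩
  · rintro ⟨u, hu⟩
    have hcomm : Commute R N := by
      rw [hN]
      exact ((Commute.one_right R).smul_right _).sub_right (Commute.refl R)
    set B : E →L[ℂ] E := ↑u⁻¹ with hB
    have hNB : N * B = 1 := by rw [← hu, hB]; simp
    have hBN : B * N = 1 := by rw [← hu, hB]; simp
    have hRB : R * B = B * R := by
      calc R * B = B * N * (R * B) := by rw [hBN, one_mul]
        _ = B * (N * R) * B := by simp only [mul_assoc]
        _ = B * (R * N) * B := by rw [hcomm.eq]
        _ = B * R * (N * B) := by simp only [mul_assoc]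
        _ = B * R := by rw [hNB, mul_one]
    refine ⟨(w - z)⁻¹ • (R * B), fun x => ?_, fun y => ?_⟩
    · obtain ⟨h, hx⟩ := hR.1 ((w - z)⁻¹ • B x)
      have e : ((w - z)⁻¹ • (R * B)) x = R ((w - z)⁻¹ • B x) := by simp
      simp only [e]
      refine ⟨h, ?_⟩
      have h3 := DFunLike.congr_fun hNB x
      simp only [hN, mul_apply_eq_comp, sub_apply, smul_apply, one_apply_eq_self] at h3
      rw [sub_eq_iff_eq_add] at hx
      rw [hx, add_sub_assoc, ← sub_smul, map_smul]
      rw [smul_smul, ← neg_sub w z, neg_mul, mul_inv_cancel₀ hd, neg_one_smul, ← sub_eq_add_neg]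
      exact h3
    · have h1 : R (T y - w • (y : E)) = (w - z) • N y := by
        have h2 := hR.2 y
        have e : T y - w • (y : E) = (T y - z • (y : E)) - (w - z) • (y : E) := by
          rw [sub_smul]; abel
        rw [e, map_sub, h2, map_smul]
        simp [hN, smul_sub, smul_smul, hd]
      have h3 := DFunLike.congr_fun hBN (y : E)
      rw [mul_apply_eq_comp] at h3
      rw [hRB, smul_apply, mul_apply_eq_comp, h1, map_smul, h3, inv_smul_smul₀ hd]
      simp

theorem IsResolventAt.adjoint {T : E →ₗ.[ℂ] E} (hT : IsSelfAdjoint T) {z : ℂ} {R : E →L[ℂ] E}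
    (hR : IsResolventAt T z R) : IsResolventAt T (star z) (star R) := by
  rw [ContinuousLinearMap.star_eq_adjoint]
  constructor
  · intro x
    have key : ∀ y : T.domain, inner ℂ (x + star z • R.adjoint x) (y : E) =
        inner ℂ (R.adjoint x) (T y) := fun y => by
      have h := R.adjoint_inner_left (T y - z • (y : E)) x
      rw [hR.2 y, inner_sub_right, inner_smul_right, sub_eq_iff_eq_add] at h
      rw [h, inner_add_left, inner_smul_left]
      simp
    have h1 : R.adjoint x ∈ T.adjoint.domain :=
      LinearPMap.mem_adjoint_domain_of_exists _ ⟨_, key⟩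
    have h2 := LinearPMap.adjoint_apply_eq hT.dense_domain ⟨_, h1⟩ key
    have h3 : ∀ S : E →ₗ.[ℂ] E, T.adjoint = S → ∃ h : R.adjoint x ∈ S.domain,
        S ⟨R.adjoint x, h⟩ = x + star z • R.adjoint x := by
      rintro _ rfl
      exact ⟨h1, h2⟩
    obtain ⟨h, h4⟩ := h3 T (LinearPMap.isSelfAdjoint_def.1 hT)
    exact ⟨h, by rw [h4, add_sub_cancel_right]⟩
  · intro y
    refine ext_inner_right ℂ fun x => ?_
    obtain ⟨h, hx⟩ := hR.1 x
    rw [ContinuousLinearMap.adjoint_inner_left, inner_sub_left,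
      hT.inner_map_left y ⟨R x, h⟩, inner_smul_left]
    nth_rewrite 3 [← hx]
    rw [inner_sub_right, inner_smul_right]
    simp

theorem IsResolventAt.isStarNormal {T : E →ₗ.[ℂ] E} (hT : IsSelfAdjoint T) {z : ℂ}
    (hz : z.im ≠ 0) {R : E →L[ℂ] E} (hR : IsResolventAt T z R) : IsStarNormal R := by
  have hQ := hR.adjoint hT
  have h1 := hR.resolvent_identity hQ
  have h2 := hQ.resolvent_identity hR
  rw [← neg_sub, h1, ← neg_sub (star z) z, neg_smul, neg_inj] at h2
  have hd : star z - z ≠ 0 := by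
    intro h
    have := congrArg Complex.im h
    simp at this
    apply hz
    linarith
  exact ⟨(smul_right_injective _ hd h2).symm⟩

theorem inner_eq_zero_of_eigenvectors {T : E →ₗ.[ℂ] E} (hT : IsSelfAdjoint T) {a b : ℝ}
    (hab : a ≠ b) {x y : T.domain} (hx : T x = (a : ℂ) • (x : E))
    (hy : T y = (b : ℂ) • (y : E)) : inner ℂ (x : E) (y : E) = 0 := by
  have h := hT.inner_map_left x y
  rw [hx, hy, inner_smul_left, inner_smul_right, Complex.conj_ofReal, ← sub_eq_zero,
    ← sub_mul] at h
  refine (mul_eq_zero.1 h).resolve_left ?_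
  exact_mod_cast sub_ne_zero.2 hab

/-- The cutoff `w ↦ max 0 (b * im w - re w)`; at `w = (t - i)⁻¹` with `t` real its value is
`max 0 (b - t) / (t ^ 2 + 1)`. -/
def cutoff (b : ℝ) (w : ℂ) : ℂ := ((max 0 (b * w.im - w.re) : ℝ) : ℂ)

theorem lipschitzWith_cutoff (b : ℝ) : LipschitzWith (Real.toNNReal (|b| + 1)) (cutoff b) := by
  refine LipschitzWith.of_dist_le_mul fun w v => ?_
  rw [Real.coe_toNNReal _ (by positivity), dist_eq_norm, dist_eq_norm, cutoff, cutoff,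
    ← Complex.ofReal_sub, Complex.norm_real, Real.norm_eq_abs]
  have h1 := abs_max_sub_max_le_abs (b * w.im - w.re) (b * v.im - v.re) 0
  rw [max_comm _ 0, max_comm _ 0] at h1
  refine h1.trans ?_
  have e : b * w.im - w.re - (b * v.im - v.re) = b * (w - v).im - (w - v).re := by
    simp; ring
  rw [e]
  refine (abs_sub _ _).trans ?_
  rw [abs_mul, add_mul, one_mul]
  gcongr
  · exact Complex.abs_im_le_norm _
  · exact Complex.abs_re_le_norm _

theorem ofReal_ne_I (t : ℝ) : (t : ℂ) ≠ Complex.I := fun h => by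
  simpa using congrArg Complex.im h

theorem cutoff_inv_sub_I (b t : ℝ) :
    cutoff b ((t : ℂ) - Complex.I)⁻¹ = ((max 0 ((b - t) / (t ^ 2 + 1)) : ℝ) : ℂ) := by
  rw [cutoff, Complex.inv_im, Complex.inv_re]
  have : Complex.normSq ((t : ℂ) - Complex.I) = t ^ 2 + 1 := by
    simp [Complex.normSq_apply]; ring
  rw [this]
  congr 2
  simp
  ring

theorem isClosed_real_pSpectrum {T : E →ₗ.[ℂ] E} {R : E →L[ℂ] E}
    (hR : IsResolventAt T Complex.I R) : IsClosed {t : ℝ | (t : ℂ) ∈ pSpectrum T} := by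
  have : {t : ℝ | (t : ℂ) ∈ pSpectrum T} =
      (fun t : ℝ => ((t : ℂ) - Complex.I)⁻¹) ⁻¹' spectrum ℂ R := by
    ext t
    exact hR.mem_pSpectrum_iff (ofReal_ne_I t)
  rw [this]
  refine (spectrum.isClosed R).preimage ?_
  exact Continuous.inv₀ (by fun_prop) fun t => sub_ne_zero.2 (ofReal_ne_I t)

theorem DiscreteIn.isCompactOperator_cfc_cutoff {T : E →ₗ.[ℂ] E} (hT : IsSelfAdjoint T)
    (hreal : pSpectrum T ⊆ Set.range Complex.ofReal) {R : E →L[ℂ] E}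
    (hR : IsResolventAt T Complex.I R) {a b d : ℝ} (hbd : b < d)
    (hbelow : ∀ t : ℝ, (t : ℂ) ∈ pSpectrum T → a ≤ t) (hdisc : DiscreteIn T a d) :
    IsCompactOperator (cfc (cutoff b) R : E →L[ℂ] E) := by
  classical
  set S := {t : ℝ | (t : ℂ) ∈ pSpectrum T} ∩ Set.Icc a b with hS
  have hScomp : IsCompact S := isCompact_Icc.inter_left (isClosed_real_pSpectrum hR)
  have hfin : S.Finite := by
    by_contra hinf
    obtain ⟨t, htS, ht⟩ := Set.Infinite.exists_accPt_of_subset_isCompact hinf hScomp subset_rfl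
    obtain ⟨-, -, ε, hε, hiso⟩ := hdisc t htS.1 (by simpa using htS.2.1)
      (by simpa using htS.2.2.trans_lt hbd)
    rw [accPt_iff_nhds] at ht
    obtain ⟨s, ⟨hs1, hs2⟩, hne⟩ := ht _ (Metric.ball_mem_nhds t hε)
    refine hne (Complex.ofReal_injective (hiso s hs2.1 ?_))
    rw [← Complex.ofReal_sub, Complex.norm_real]
    exact hs1
  have hfd := finiteDimensional_range_cfc (hR.isStarNormal hT (by simp))
    (hfin.toFinset.image fun t : ℝ => ((t : ℂ) - Complex.I)⁻¹) (fun w hw => ?_)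
    (lipschitzWith_cutoff b).continuous (fun w hw hws => ?_)
  · exact isCompactOperator_of_finiteDimensional_range _
  · obtain ⟨t, ht, rfl⟩ := Finset.mem_image.1 hw
    have htS : t ∈ S := hfin.mem_toFinset.1 ht
    obtain ⟨-, hfd, -⟩ := hdisc t htS.1 (by simpa using htS.2.1)
      (by simpa using htS.2.2.trans_lt hbd)
    refine Submodule.finiteDimensional_of_le (S₂ := (pEigenspace T t).map T.domain.subtype) ?_
    intro x hx
    rw [Module.End.mem_eigenspace_iff] at hx
    obtain ⟨h, h1⟩ := hR.eigenvector_of_map (ofReal_ne_I t) hx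
    refine ⟨⟨x, h⟩, ?_, rfl⟩
    simpa [pEigenspace, sub_eq_zero] using h1
  · rcases eq_or_ne w 0 with rfl | hw0
    · simp [cutoff]
    have e : w = ((Complex.I + w⁻¹) - Complex.I)⁻¹ := by simp
    have h1 : Complex.I + w⁻¹ ∈ pSpectrum T := by
      rw [hR.mem_pSpectrum_iff (by simpa using hw0), ← e]
      exact hw
    obtain ⟨t, ht⟩ := hreal h1
    change (t : ℂ) = _ at ht
    rw [← ht] at e h1
    have htb : b < t := by
      by_contra! hle
      exact hws (Finset.mem_image.2 ⟨t, hfin.mem_toFinset.2 ⟨h1, hbelow t h1, hle⟩, e.symm⟩)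
    rw [e, cutoff_inv_sub_I, max_eq_left, Complex.ofReal_zero]
    exact div_nonpos_of_nonpos_of_nonneg (by linarith) (by positivity)

section Limit

variable {T : E →ₗ.[ℂ] E} {R : E →L[ℂ] E} {b : ℝ}

theorem cutoff_inv_sub_I_ne_zero {t : ℝ} (ht : t < b) :
    cutoff b ((t : ℂ) - Complex.I)⁻¹ ≠ 0 := by
  rw [cutoff_inv_sub_I, Complex.ofReal_ne_zero]
  have : 0 < (b - t) / (t ^ 2 + 1) := div_pos (by linarith) (by positivity)
  exact (lt_max_of_lt_right this).ne'

theorem exists_unit_eigenvector (hT : IsSelfAdjoint T) (hR : IsResolventAt T Complex.I R)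
    (hK : IsCompactOperator (cfc (cutoff b) R : E →L[ℂ] E)) {t : ℝ}
    (ht : (t : ℂ) ∈ pSpectrum T) (htb : t < b) :
    ∃ x : T.domain, ‖(x : E)‖ = 1 ∧ T x = (t : ℂ) • (x : E) := by
  have hn := hR.isStarNormal hT (by simp)
  have hw := (hR.mem_pSpectrum_iff (ofReal_ne_I t)).1 ht
  choose x hx1 hx2 using fun n : ℕ =>
    exists_approx_eigenvector hn hw (ε := 1 / ((n : ℝ) + 1)) (by positivity)
  obtain ⟨y, -, -, -, hy1, hy⟩ := exists_subseq_tendsto_eigenvector hn (lipschitzWith_cutoff b) hK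
    (cutoff_inv_sub_I_ne_zero htb) hx1
    (squeeze_zero_norm (fun n => (hx2 n).le) tendsto_one_div_add_atTop_nhds_zero_nat)
  obtain ⟨h, h1⟩ := hR.eigenvector_of_map (ofReal_ne_I t) hy
  exact ⟨⟨y, h⟩, hy1, h1⟩

theorem finiteDimensional_pEigenspace (hT : IsSelfAdjoint T) (hR : IsResolventAt T Complex.I R)
    (hK : IsCompactOperator (cfc (cutoff b) R : E →L[ℂ] E)) {t : ℝ} (htb : t < b) :
    FiniteDimensional ℂ (pEigenspace T t) := by
  have hn := hR.isStarNormal hT (by simp)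
  have hfd := ContinuousLinearMap.finite_dimensional_eigenspace hK _
    (cutoff_inv_sub_I_ne_zero htb)
  have hmap : ∀ x ∈ pEigenspace T t, T.domain.subtype x ∈ Module.End.eigenspace
      (cfc (cutoff b) R : E →L[ℂ] E).toLinearMap (cutoff b ((t : ℂ) - Complex.I)⁻¹) := by
    intro x hx
    have hx' : T x = (t : ℂ) • (x : E) := by
      simpa [pEigenspace, sub_eq_zero] using hx
    have h1 := hR.map_of_eigenvector (ofReal_ne_I t) hx'
    have h2 := norm_cfc_sub_apply_le hn (lipschitzWith_cutoff b) ((t : ℂ) - Complex.I)⁻¹ (x : E)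
    rw [h1, sub_self, norm_zero, mul_zero, norm_le_zero_iff, sub_eq_zero] at h2
    rw [Module.End.mem_eigenspace_iff]
    exact h2
  refine FiniteDimensional.of_injective (T.domain.subtype.restrict hmap) fun x y hxy => ?_
  have h := congrArg (Submodule.subtype _) hxy
  exact Subtype.ext (Subtype.ext h)

theorem exists_isolating_radius (hT : IsSelfAdjoint T)
    (hreal : pSpectrum T ⊆ Set.range Complex.ofReal) (hR : IsResolventAt T Complex.I R)
    (hK : IsCompactOperator (cfc (cutoff b) R : E →L[ℂ] E)) {t : ℝ} (htb : t < b) :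
    ∃ ε > (0 : ℝ), ∀ w ∈ pSpectrum T, ‖w - t‖ < ε → w = t := by
  by_contra! hcon
  have hn := hR.isStarNormal hT (by simp)
  have hex : ∀ n : ℕ, ∃ s : ℝ, (s : ℂ) ∈ pSpectrum T ∧ |s - t| < 1 / ((n : ℝ) + 1) ∧ s < b ∧
      s ≠ t := fun n => by
    obtain ⟨w, hw, hwt, hne⟩ := hcon (min (1 / ((n : ℝ) + 1)) (b - t))
      (lt_min (by positivity) (by linarith))
    obtain ⟨s, rfl⟩ := hreal hw
    change ‖(s : ℂ) - t‖ < _ at hwt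
    rw [← Complex.ofReal_sub, Complex.norm_real, Real.norm_eq_abs, lt_min_iff] at hwt
    exact ⟨s, hw, hwt.1, by linarith [le_abs_self (s - t)], fun h => hne (by rw [h])⟩
  choose s hs hst hsb hne using hex
  choose x hx1 hx using fun n => exists_unit_eigenvector hT hR hK (hs n) (hsb n)
  have hs_lim : Tendsto s atTop (𝓝 t) := by
    rw [tendsto_iff_norm_sub_tendsto_zero]
    exact squeeze_zero (fun n => norm_nonneg _) (fun n => (hst n).le)
      tendsto_one_div_add_atTop_nhds_zero_nat
  have hw_lim : Tendsto (fun n => ((s n : ℂ) - Complex.I)⁻¹ - ((t : ℂ) - Complex.I)⁻¹) atTop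
      (𝓝 0) := by
    rw [← sub_self ((t : ℂ) - Complex.I)⁻¹]
    refine Tendsto.sub_const (Tendsto.inv₀ (Tendsto.sub_const ?_ _)
      (sub_ne_zero.2 (ofReal_ne_I t))) _
    exact (Complex.continuous_ofReal.tendsto t).comp hs_lim
  obtain ⟨y, φ, -, hlim, hy1, hy⟩ := exists_subseq_tendsto_eigenvector hn
    (lipschitzWith_cutoff b) hK (cutoff_inv_sub_I_ne_zero htb) hx1 (by
      refine squeeze_zero_norm (fun n => ?_) (by simpa using hw_lim.norm)
      rw [hR.map_of_eigenvector (ofReal_ne_I (s n)) (hx n), ← sub_smul, norm_smul, hx1 n,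
        mul_one])
  obtain ⟨h, hTy⟩ := hR.eigenvector_of_map (ofReal_ne_I t) hy
  have h0 : inner ℂ y y = 0 := by
    refine tendsto_nhds_unique (hlim.inner (tendsto_const_nhds (x := y))) ?_
    refine tendsto_const_nhds.congr fun n => ?_
    exact (inner_eq_zero_of_eigenvectors hT (hne (φ n)) (hx (φ n)) (y := ⟨y, h⟩) hTy).symm
  rw [inner_self_eq_zero] at h0
  simp [h0] at hy1

end Limit

/-- If self-adjoint operators `Hₙ`, uniformly bounded below, converge to `H` in norm
resolvent sense, each `Hₙ` has purely discrete spectrum in `[E₀(Hₙ), E₀(Hₙ) + m)` and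
`E₀(Hₙ) → E₀(H)`, then `H` has purely discrete spectrum in `[E₀(H), E₀(H) + m)`;
in particular `H` has a ground state. -/
theorem stmt_13 (Hn : ℕ → (E →ₗ.[ℂ] E)) (H : E →ₗ.[ℂ] E) (m : ℝ) (hm : 0 < m)
    (hsan : ∀ n, IsSelfAdjoint (Hn n)) (hsa : IsSelfAdjoint H)
    (hreal : ∀ n, pSpectrum (Hn n) ⊆ Set.range Complex.ofReal)
    (hrealH : pSpectrum H ⊆ Set.range Complex.ofReal)
    (hHne : {x : ℝ | (x : ℂ) ∈ pSpectrum H}.Nonempty)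
    (c : ℝ)
    (hbelow : ∀ n, ∀ x : ℝ, (x : ℂ) ∈ pSpectrum (Hn n) → c ≤ x)
    (hbelowH : ∀ x : ℝ, (x : ℂ) ∈ pSpectrum H → c ≤ x)
    (Rn : ℕ → (E →L[ℂ] E)) (R : E →L[ℂ] E)
    (hRn : ∀ n, IsResolventAt (Hn n) Complex.I (Rn n))
    (hR : IsResolventAt H Complex.I R)
    (hnorm : Tendsto (fun n => ‖Rn n - R‖) atTop (𝓝 0))
    (hdiscn : ∀ n, DiscreteIn (Hn n) (groundEnergy (Hn n)) (groundEnergy (Hn n) + m))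
    (hE0 : Tendsto (fun n => groundEnergy (Hn n)) atTop (𝓝 (groundEnergy H))) :
    DiscreteIn H (groundEnergy H) (groundEnergy H + m) ∧
    IsEigenvalue H ((groundEnergy H : ℝ) : ℂ) := by
  have hbdd : BddBelow {x : ℝ | (x : ℂ) ∈ pSpectrum H} := ⟨c, hbelowH⟩
  have hcompact : ∀ b < groundEnergy H + m,
      IsCompactOperator (cfc (cutoff b) R : E →L[ℂ] E) := by
    intro b hb
    have hRlim : Tendsto Rn atTop (𝓝 R) := tendsto_iff_norm_sub_tendsto_zero.2 hnorm
    have hball : ∀ᶠ n in atTop, spectrum ℂ (Rn n) ⊆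
        Metric.closedBall 0 ((‖R‖ + 1) * ‖(1 : E →L[ℂ] E)‖) := by
      filter_upwards [hRlim.norm.eventually_le_const (lt_add_one ‖R‖)] with n hn
      refine (spectrum.subset_closedBall_norm_mul _).trans (Metric.closedBall_subset_closedBall ?_)
      gcongr
    refine isCompactOperator_of_tendsto
      (hRlim.cfc (isCompact_closedBall 0 _) (cutoff b) hball
        (Eventually.of_forall fun n => (hRn n).isStarNormal (hsan n) (by simp)) ?_
        (hR.isStarNormal hsa (by simp)) (lipschitzWith_cutoff b).continuous.continuousOn) ?_
    · refine (spectrum.subset_closedBall_norm_mul _).trans (Metric.closedBall_subset_closedBall ?_)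
      gcongr
      linarith
    · filter_upwards [(hE0.add_const m).eventually_const_lt hb] with n hn
      exact (hdiscn n).isCompactOperator_cfc_cutoff (hsan n) (hreal n) (hRn n) hn
        fun t ht => csInf_le ⟨c, hbelow n⟩ ht
  have hdisc : DiscreteIn H (groundEnergy H) (groundEnergy H + m) := by
    intro z hz _ hzm
    obtain ⟨t, rfl⟩ := hrealH hz
    obtain ⟨b, htb, hb⟩ := exists_between hzm
    have hK := hcompact b hb
    obtain ⟨x, hx1, hx⟩ := exists_unit_eigenvector hsa hR hK hz htb
    refine ⟨⟨x, fun h => ?_, hx⟩, finiteDimensional_pEigenspace hsa hR hK htb,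
      exists_isolating_radius hsa hrealH hR hK htb⟩
    simp [h] at hx1
  have hmem : ((groundEnergy H : ℝ) : ℂ) ∈ pSpectrum H :=
    (isClosed_real_pSpectrum hR).csInf_mem hHne hbdd
  exact ⟨hdisc, (hdisc _ hmem le_rfl (lt_add_of_pos_right _ hm)).1⟩

end
end
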